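/- Let m be a natural number, let a be a complex number with 0 < Re a < 1, let c be a real number with −Re a < c < 0, and let z be a complex number with |z| > 1 and z ∉ [0,∞). Then (1/2π) ∫_{−∞}^{∞} Γ(1+c+it) Γ(−c−it) (−z)^{c+it} (a+c+it)^m dt = −(−1)^m ∑_{n=1}^∞ (n−a)^m z^{−n}. In other words, for s = −m a non-positive integer the large-z expansion of the Lerch transcendent has no branch-point contribution and consists solely of the convergent series −e^{−πis} ∑_{n=1}^∞ z^{−n}/(n−a)^s. -/

import Mathlib

open Complex MeasureTheory Set

open Filter Topology

lemma integral_inv_add_mul_I {x : ℝ} (hx : x ≠ 0) (T : ℝ) :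
    ∫ t in (-T)..T, ((x : ℂ) + t * I)⁻¹ = 2 * (Real.arctan (T / x) : ℂ) := by
  have hpos : ∀ t : ℝ, 0 < x ^ 2 + t ^ 2 := fun t => by positivity
  have hne : ∀ t : ℝ, (x : ℂ) + t * I ≠ 0 := fun t h => hx (by simpa using congrArg re h)
  have key : ∀ t ∈ uIcc (-T) T, HasDerivAt
      (fun t : ℝ => (Real.arctan (t / x) : ℂ) - I / 2 * (Real.log (x ^ 2 + t ^ 2) : ℂ))
      (((x : ℂ) + t * I)⁻¹) t := by
    intro t _
    have h1 : HasDerivAt (fun t : ℝ => Real.arctan (t / x)) (1 / (1 + (t / x) ^ 2) * (1 / x)) t :=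
      ((hasDerivAt_id t).div_const x).arctan
    have h2 : HasDerivAt (fun t : ℝ => Real.log (x ^ 2 + t ^ 2))
        ((2 * t) / (x ^ 2 + t ^ 2)) t := by
      have := ((hasDerivAt_pow 2 t).const_add (x ^ 2)).log (hpos t).ne'
      simpa using this
    refine (h1.ofReal_comp.sub (h2.ofReal_comp.const_mul (I / 2))).congr_deriv ?_
    have hc : (x : ℂ) ^ 2 + (t : ℂ) ^ 2 ≠ 0 := by exact_mod_cast (hpos t).ne'
    have hx' : (x : ℂ) ≠ 0 := by exact_mod_cast hx
    have h3 : ((x : ℂ) + t * I)⁻¹ = (x - t * I) / ((x : ℂ) ^ 2 + t ^ 2) := by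
      rw [inv_eq_one_div, div_eq_div_iff (hne t) hc]
      linear_combination ((t : ℂ) ^ 2) * I_sq
    have h4 : 1 / (1 + (t / x) ^ 2) * (1 / x) = x / (x ^ 2 + t ^ 2) := by
      have := (hpos t).ne'
      field_simp
    rw [h3, h4]
    push_cast
    field_simp
  rw [intervalIntegral.integral_eq_sub_of_hasDerivAt key
    (Continuous.intervalIntegrable (by
      refine Continuous.inv₀ (by fun_prop) hne) _ _)]
  simp only [neg_div, Real.arctan_neg, neg_sq]
  push_cast
  ring

lemma tendsto_integral_inv_add_mul_I_of_pos {x : ℝ} (hx : 0 < x) :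
    Tendsto (fun T : ℝ => ∫ t in (-T)..T, ((x : ℂ) + t * I)⁻¹) atTop (𝓝 (Real.pi : ℂ)) := by
  simp_rw [integral_inv_add_mul_I hx.ne']
  have h := (tendsto_nhds_of_tendsto_nhdsWithin Real.tendsto_arctan_atTop).comp
    (tendsto_id.atTop_div_const hx)
  have := ((continuous_ofReal.tendsto _).comp h).const_mul (2 : ℂ)
  have hpi : (2 : ℂ) * ((Real.pi / 2 : ℝ) : ℂ) = Real.pi := by push_cast; ring
  rwa [hpi] at this

lemma tendsto_integral_inv_add_mul_I_of_neg {x : ℝ} (hx : x < 0) :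
    Tendsto (fun T : ℝ => ∫ t in (-T)..T, ((x : ℂ) + t * I)⁻¹) atTop (𝓝 (-(Real.pi : ℂ))) := by
  refine (tendsto_integral_inv_add_mul_I_of_pos (neg_pos.2 hx)).neg.congr fun T => ?_
  rw [integral_inv_add_mul_I (neg_pos.2 hx).ne', integral_inv_add_mul_I hx.ne, div_neg,
    Real.arctan_neg]
  push_cast
  ring

/-- Moving a vertical line of integration across a simple pole at the origin. -/
theorem integral_vertical_sub_eq_two_pi_mul_residue {u : ℂ → ℂ} {U : Set ℂ} (hU : IsOpen U)
    {α β : ℝ} (hα : α < 0) (hβ : 0 < β) (hsub : ∀ w : ℂ, w.re ∈ Icc α β → w ∈ U)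
    (hu : DifferentiableOn ℂ u U)
    (hiα : Integrable fun t : ℝ => u (α + t * I) / (α + t * I))
    (hiβ : Integrable fun t : ℝ => u (β + t * I) / (β + t * I))
    {B : ℝ → ℝ} (hB : Tendsto B atTop (𝓝 0))
    (hbound : ∀ᶠ T in atTop, ∀ x ∈ Icc α β, ∀ t : ℝ, |t| = T →
      ‖u (x + t * I) / (x + t * I)‖ ≤ B T) :
    (∫ t : ℝ, u (β + t * I) / (β + t * I)) - ∫ t : ℝ, u (α + t * I) / (α + t * I) =
      2 * Real.pi * u 0 := by
  have h0 : (0 : ℂ) ∈ U := hsub 0 ⟨hα.le, hβ.le⟩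
  set g := dslope u 0 with hg
  have hgd : DifferentiableOn ℂ g U :=
    (Complex.differentiableOn_dslope (hU.mem_nhds h0)).2 hu
  have hgeq : ∀ w : ℂ, w ≠ 0 → g w = u w / w - u 0 * w⁻¹ := by
    intro w hw
    rw [hg, dslope_of_ne _ hw, slope_def_field]
    field_simp
    simp
  have hvert : ∀ {x : ℝ} (_ : x ≠ 0) {p : ℂ}
      (_ : Integrable fun t : ℝ => u (x + t * I) / (x + t * I))
      (_ : Tendsto (fun T : ℝ => ∫ t in (-T)..T, ((x : ℂ) + t * I)⁻¹) atTop (𝓝 p)),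
      Tendsto (fun T : ℝ => ∫ t in (-T)..T, g (x + t * I)) atTop
        (𝓝 ((∫ t : ℝ, u (x + t * I) / (x + t * I)) - u 0 * p)) := by
    intro x hx p hi hp
    have hne : ∀ t : ℝ, (x : ℂ) + t * I ≠ 0 := fun t h => hx (by simpa using congrArg re h)
    refine ((intervalIntegral_tendsto_integral hi tendsto_neg_atTop_atBot tendsto_id).sub
      (hp.const_mul (u 0))).congr fun T => ?_
    simp_rw [hgeq _ (hne _)]
    rw [intervalIntegral.integral_sub hi.intervalIntegrable, intervalIntegral.integral_const_mul]
    · rfl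
    · exact Continuous.intervalIntegrable
        (continuous_const.mul (Continuous.inv₀ (by fun_prop) hne)) _ _
  have hhor : ∀ {σ : ℝ} (_ : |σ| = 1),
      Tendsto (fun T : ℝ => ∫ x in α..β, g (x + (σ * T : ℝ) * I)) atTop (𝓝 0) := by
    intro σ hσ
    have hlim : Tendsto (fun T : ℝ => (B T + ‖u 0‖ * T⁻¹) * |β - α|) atTop (𝓝 0) := by
      simpa using (hB.add (tendsto_inv_atTop_zero.const_mul ‖u 0‖)).mul_const |β - α|
    refine squeeze_zero_norm' ?_ hlim
    filter_upwards [hbound, eventually_gt_atTop 0] with T hT hT0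
    refine intervalIntegral.norm_integral_le_of_norm_le_const fun x hx => ?_
    rw [uIoc_of_le (hα.trans hβ).le] at hx
    have habs : |σ * T| = T := by rw [abs_mul, hσ, one_mul, abs_of_pos hT0]
    have him : T ≤ ‖(x : ℂ) + (σ * T : ℝ) * I‖ := by
      have := abs_im_le_norm ((x : ℂ) + (σ * T : ℝ) * I)
      simp only [add_im, ofReal_im, mul_im, ofReal_re, I_im, I_re, mul_one, mul_zero, add_zero,
        zero_add] at this
      rwa [habs] at this
    rw [hgeq _ (norm_pos_iff.1 (hT0.trans_le him))]
    refine (norm_sub_le _ _).trans (add_le_add (hT x ⟨hx.1.le, hx.2⟩ _ habs) ?_)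
    rw [norm_mul, norm_inv]
    gcongr
  have hrect : ∀ T : ℝ,
      (∫ x in α..β, g (x + ((-1 : ℝ) * T : ℝ) * I)) - (∫ x in α..β, g (x + ((1 : ℝ) * T : ℝ) * I))
        + I * (∫ t in (-T)..T, g (β + t * I)) - I * (∫ t in (-T)..T, g (α + t * I)) = 0 := by
    intro T
    have := integral_boundary_rect_eq_zero_of_differentiableOn g ⟨α, -T⟩ ⟨β, T⟩
      (hgd.mono fun w hw => hsub w (by
        have := hw.1
        rwa [uIcc_of_le (hα.trans hβ).le] at this))
    simpa using this
  have hlim := (((hhor (σ := -1) (by simp)).sub (hhor (σ := 1) (by simp))).add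
    ((hvert hβ.ne' hiβ (tendsto_integral_inv_add_mul_I_of_pos hβ)).const_mul I)).sub
    ((hvert hα.ne hiα (tendsto_integral_inv_add_mul_I_of_neg hα)).const_mul I)
  have h := tendsto_nhds_unique (hlim.congr hrect) tendsto_const_nhds
  refine mul_left_cancel₀ I_ne_zero ?_
  linear_combination h

lemma integrable_exp_neg_mul_abs {δ : ℝ} (hδ : 0 < δ) :
    Integrable fun t : ℝ => Real.exp (-δ * |t|) := by
  rw [← integrableOn_univ, ← Iic_union_Ioi (a := (0 : ℝ))]
  refine IntegrableOn.union ?_ ?_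
  · refine (integrableOn_exp_mul_Iic hδ 0).congr_fun (fun t ht => ?_) measurableSet_Iic
    simp [abs_of_nonpos (mem_Iic.1 ht)]
  · refine (integrableOn_exp_mul_Ioi (neg_lt_zero.2 hδ) 0).congr_fun (fun t ht => ?_)
      measurableSet_Ioi
    simp [abs_of_pos (mem_Ioi.1 ht)]

lemma exists_add_pow_le_mul_exp {δ : ℝ} (hδ : 0 < δ) (m : ℕ) :
    ∃ K : ℝ, 0 < K ∧ ∀ t : ℝ, 0 ≤ t → (1 + t) ^ m ≤ K * Real.exp (δ * t) := by
  refine ⟨m.factorial / δ ^ m * Real.exp δ, by positivity, fun t ht => ?_⟩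
  have h := Real.pow_div_factorial_le_exp (δ * (1 + t)) (by positivity) m
  rw [div_le_iff₀ (by positivity), mul_pow] at h
  rw [mul_assoc, ← Real.exp_add, div_mul_eq_mul_div, le_div_iff₀ (by positivity)]
  calc (1 + t) ^ m * δ ^ m = δ ^ m * (1 + t) ^ m := mul_comm _ _
    _ ≤ _ := h
    _ = _ := by rw [mul_comm]; congr 2; ring

lemma abs_sin_mul_cosh_le_norm_sin (x y : ℝ) :
    |Real.sin x| * Real.cosh y ≤ ‖Complex.sin (x + y * I)‖ := by
  have h := abs_re_le_norm (Complex.sin (x + y * I))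
  have e : (Complex.sin (x + y * I)).re = Real.sin x * Real.cosh y := by
    rw [Complex.sin_add_mul_I, ← ofReal_sin, ← ofReal_cos, ← ofReal_sinh, ← ofReal_cosh,
      add_re, ← ofReal_mul, ofReal_re, ← ofReal_mul, re_ofReal_mul, I_re, mul_zero, add_zero]
  rwa [e, abs_mul, abs_of_pos (Real.cosh_pos y)] at h

lemma abs_sinh_le_norm_sin (x y : ℝ) : |Real.sinh y| ≤ ‖Complex.sin (x + y * I)‖ := by
  rw [Complex.sin_add_mul_I, ← ofReal_sin, ← ofReal_cos, ← ofReal_sinh, ← ofReal_cosh,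
    ← ofReal_mul, ← ofReal_mul, norm_add_mul_I]
  refine Real.abs_le_sqrt ?_
  nlinarith [Real.sin_sq_add_cos_sq x, Real.cosh_sq y, sq_nonneg (Real.sin x)]

lemma exp_le_two_mul_cosh (y : ℝ) : Real.exp |y| ≤ 2 * Real.cosh y := by
  rw [← Real.cosh_abs, Real.cosh_eq]
  linarith [Real.exp_pos (-|y|)]

lemma exp_le_four_mul_abs_sinh {y : ℝ} (hy : 1 ≤ |y|) : Real.exp |y| ≤ 4 * |Real.sinh y| := by
  rw [Real.abs_sinh, Real.sinh_eq]
  have h1 : 2 ≤ Real.exp |y| := by linarith [Real.add_one_le_exp |y|]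
  have h2 : Real.exp (-|y|) ≤ 1 := Real.exp_le_one_iff.2 (by linarith)
  linarith

/-- The Mellin-Barnes integrand of the Lerch transcendent at argument `-y`, parameter `b` and
order `-m`, as a function of `w = s + 1`, with the Gamma factors replaced by `-π / sin (π s)`. -/
noncomputable def lerchIntegrand (m : ℕ) (y b w : ℂ) : ℂ :=
  Real.pi * y ^ (w - 1) * (b + w - 1) ^ m / Complex.sin (Real.pi * w)

lemma exists_norm_numerator_le (m : ℕ) {y : ℂ} (hy : 1 ≤ ‖y‖) {δ : ℝ} (hδ : 0 < δ) :
    ∃ K : ℝ, 0 < K ∧ ∀ b : ℂ, ∀ x ∈ Icc (-1 : ℝ) 1, ∀ t : ℝ,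
      ‖Real.pi * y ^ ((x + t * I : ℂ) - 1) * (b + (x + t * I) - 1) ^ m‖ ≤
        (‖b‖ + 2) ^ m * K * Real.exp ((|arg y| + δ) * |t|) := by
  obtain ⟨K, hK, hKle⟩ := exists_add_pow_le_mul_exp hδ m
  refine ⟨Real.pi * K, by positivity, fun b x hx t => ?_⟩
  have hy0 : y ≠ 0 := norm_pos_iff.1 (by linarith)
  have h1 : ‖y ^ ((x + t * I : ℂ) - 1)‖ ≤ Real.exp (|arg y| * |t|) := by
    rw [norm_cpow_of_ne_zero hy0, div_eq_mul_inv, ← Real.exp_neg]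
    have ha : ‖y‖ ^ ((x + t * I : ℂ) - 1).re ≤ 1 :=
      Real.rpow_le_one_of_one_le_of_nonpos hy (by simpa using hx.2)
    have hb : -(arg y * ((x + t * I : ℂ) - 1).im) ≤ |arg y| * |t| := by
      rw [← abs_mul]
      simpa using neg_le_abs (arg y * t)
    calc _ ≤ 1 * Real.exp (|arg y| * |t|) := by gcongr
      _ = _ := one_mul _
  have h2 : ‖b + (x + t * I) - 1‖ ≤ (‖b‖ + 2) * (1 + |t|) := by
    have e : b + (x + t * I) - 1 = b + (x - 1 : ℝ) + t * I := by push_cast; ring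
    have hx2 : |x - 1| ≤ 2 := abs_le.2 ⟨by linarith [hx.1], by linarith [hx.2]⟩
    rw [e]
    have h3 := norm_add₃_le (a := b) (b := ((x - 1 : ℝ) : ℂ)) (c := t * I)
    rw [norm_mul, norm_I, mul_one, norm_real, norm_real, Real.norm_eq_abs, Real.norm_eq_abs] at h3
    nlinarith [norm_nonneg b, abs_nonneg t, mul_nonneg (norm_nonneg b) (abs_nonneg t)]
  rw [norm_mul, norm_mul, norm_pow, norm_real, Real.norm_eq_abs, abs_of_pos Real.pi_pos]
  calc Real.pi * ‖y ^ ((x + t * I : ℂ) - 1)‖ * ‖b + (x + t * I) - 1‖ ^ m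
      ≤ Real.pi * Real.exp (|arg y| * |t|) * ((‖b‖ + 2) * (1 + |t|)) ^ m := by gcongr
    _ = Real.pi * Real.exp (|arg y| * |t|) * ((‖b‖ + 2) ^ m * (1 + |t|) ^ m) := by rw [mul_pow]
    _ ≤ Real.pi * Real.exp (|arg y| * |t|) * ((‖b‖ + 2) ^ m * (K * Real.exp (δ * |t|))) := by
        gcongr
        exact hKle _ (abs_nonneg t)
    _ = _ := by rw [add_mul, Real.exp_add]; ring

lemma exists_norm_lerchIntegrand_le (m : ℕ) {y : ℂ} (hy : 1 ≤ ‖y‖) (harg : |arg y| < Real.pi) :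
    ∃ δ K : ℝ, 0 < δ ∧ 0 < K ∧
      (∀ b : ℂ, ∀ x ∈ Icc (-1 : ℝ) 1, ∀ t : ℝ, Real.sin (Real.pi * x) ≠ 0 →
        ‖lerchIntegrand m y b (x + t * I)‖ ≤
          (‖b‖ + 2) ^ m * (K / |Real.sin (Real.pi * x)|) * Real.exp (-δ * |t|)) ∧
      (∀ b : ℂ, ∀ x ∈ Icc (-1 : ℝ) 1, ∀ t : ℝ, 1 ≤ |t| →
        ‖lerchIntegrand m y b (x + t * I)‖ ≤ (‖b‖ + 2) ^ m * K * Real.exp (-δ * |t|)) := by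
  obtain ⟨δ, hδ, hδe⟩ : ∃ δ : ℝ, 0 < δ ∧ |arg y| + δ = Real.pi - δ :=
    ⟨(Real.pi - |arg y|) / 2, by linarith, by ring⟩
  obtain ⟨K, hK, hKle⟩ := exists_norm_numerator_le m hy hδ
  rw [hδe] at hKle
  have hexp : ∀ t : ℝ, Real.exp ((Real.pi - δ) * |t|) =
      Real.exp (-δ * |t|) * Real.exp |Real.pi * t| := fun t => by
    rw [← Real.exp_add, abs_mul, abs_of_pos Real.pi_pos]
    ring_nf
  have harg' : ∀ x t : ℝ, (Real.pi * (x + t * I) : ℂ) =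
      (Real.pi * x : ℝ) + (Real.pi * t : ℝ) * I := fun x t => by push_cast; ring
  refine ⟨δ, 4 * K, hδ, by positivity, fun b x hx t hs => ?_, fun b x hx t ht => ?_⟩
  · have hs' : 0 < |Real.sin (Real.pi * x)| := abs_pos.2 hs
    have h1 := abs_sin_mul_cosh_le_norm_sin (Real.pi * x) (Real.pi * t)
    have hc := Real.cosh_pos (Real.pi * t)
    rw [lerchIntegrand, norm_div, harg', div_le_iff₀ ((by positivity : (0:ℝ) < _).trans_le h1),
      ← harg']
    refine (hKle b x hx t).trans ?_
    rw [hexp, harg']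
    calc (‖b‖ + 2) ^ m * K * (Real.exp (-δ * |t|) * Real.exp |Real.pi * t|)
        ≤ (‖b‖ + 2) ^ m * K * (Real.exp (-δ * |t|) * (4 * Real.cosh (Real.pi * t))) := by
          gcongr
          linarith [exp_le_two_mul_cosh (Real.pi * t)]
      _ = (‖b‖ + 2) ^ m * (4 * K / |Real.sin (Real.pi * x)|) * Real.exp (-δ * |t|) *
          (|Real.sin (Real.pi * x)| * Real.cosh (Real.pi * t)) := by
          field_simp
      _ ≤ _ := by gcongr
  · have hpt : 1 ≤ |Real.pi * t| := by
      rw [abs_mul, abs_of_pos Real.pi_pos]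
      nlinarith [Real.pi_gt_three]
    have h0 := exp_le_four_mul_abs_sinh hpt
    have h1 := abs_sinh_le_norm_sin (Real.pi * x) (Real.pi * t)
    rw [lerchIntegrand, norm_div, harg', div_le_iff₀ (by linarith [Real.exp_pos |Real.pi * t|]),
      ← harg']
    refine (hKle b x hx t).trans ?_
    rw [hexp, harg']
    calc (‖b‖ + 2) ^ m * K * (Real.exp (-δ * |t|) * Real.exp |Real.pi * t|)
        ≤ (‖b‖ + 2) ^ m * K * (Real.exp (-δ * |t|) *
          (4 * ‖Complex.sin ((Real.pi * x : ℝ) + (Real.pi * t : ℝ) * I)‖)) := by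
          gcongr
          linarith
      _ = _ := by ring

lemma sin_pi_mul_ne_zero_of_re {w : ℂ} (h : ∀ k : ℤ, w.re ≠ k) :
    Complex.sin (Real.pi * w) ≠ 0 := by
  refine sin_pi_mul_ne_zero ?_
  rintro ⟨k, rfl⟩
  exact h k (intCast_re k)

lemma real_sin_pi_mul_ne_zero {x : ℝ} (h : ∀ k : ℤ, x ≠ k) : Real.sin (Real.pi * x) ≠ 0 := by
  have := sin_pi_mul_ne_zero_of_re (w := x) (by simpa using h)
  exact_mod_cast this

lemma ne_intCast_of_lt_of_lt {x : ℝ} {n : ℤ} (h1 : (n : ℝ) < x) (h2 : x < n + 1) (k : ℤ) :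
    x ≠ k := by
  rintro rfl
  have h1' : n < k := by exact_mod_cast h1
  have h2' : k < n + 1 := by exact_mod_cast h2
  omega

lemma continuous_lerchIntegrand_vertical (m : ℕ) {y : ℂ} (hy : y ≠ 0) (b : ℂ) {x : ℝ}
    (h : ∀ k : ℤ, x ≠ k) : Continuous fun t : ℝ => lerchIntegrand m y b (x + t * I) := by
  unfold lerchIntegrand
  refine Continuous.div ?_ (by fun_prop) fun t => sin_pi_mul_ne_zero_of_re (by simpa using h)
  refine Continuous.mul (continuous_const.mul ?_) (by fun_prop)
  exact Continuous.const_cpow (by fun_prop) (Or.inl hy)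

lemma exists_integrable_lerchIntegrand (m : ℕ) {y : ℂ} (hy : 1 ≤ ‖y‖) (harg : |arg y| < Real.pi)
    {x : ℝ} (hx : x ∈ Icc (-1 : ℝ) 1) (h : ∀ k : ℤ, x ≠ k) :
    (∀ b : ℂ, Integrable fun t : ℝ => lerchIntegrand m y b (x + t * I)) ∧
    ∃ C : ℝ, ∀ b : ℂ, ‖∫ t : ℝ, lerchIntegrand m y b (x + t * I)‖ ≤ (‖b‖ + 2) ^ m * C := by
  obtain ⟨δ, K, hδ, hK, hline, -⟩ := exists_norm_lerchIntegrand_le m hy harg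
  have hs := real_sin_pi_mul_ne_zero h
  have hint := integrable_exp_neg_mul_abs hδ
  refine ⟨fun b => ?_, K / |Real.sin (Real.pi * x)| * ∫ t : ℝ, Real.exp (-δ * |t|), fun b => ?_⟩
  · refine (hint.const_mul ((‖b‖ + 2) ^ m * (K / |Real.sin (Real.pi * x)|))).mono'
      (continuous_lerchIntegrand_vertical m (norm_pos_iff.1 (by linarith)) b
        h).aestronglyMeasurable (ae_of_all _ fun t => hline b x hx t hs)
  · rw [← mul_assoc, ← integral_const_mul]
    exact norm_integral_le_of_norm_le (hint.const_mul _)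
      (ae_of_all _ fun t => hline b x hx t hs)

lemma lerchIntegrand_sub_one (m : ℕ) {y : ℂ} (hy : y ≠ 0) (b w : ℂ) :
    lerchIntegrand m y b (w - 1) = -(y⁻¹ * lerchIntegrand m y (b - 1) w) := by
  have h1 : y ^ (w - 1 - 1) = y ^ (w - 1) * y⁻¹ := by
    rw [cpow_sub _ _ hy, cpow_one, div_eq_mul_inv]
  have h2 : Complex.sin (Real.pi * (w - 1)) = -Complex.sin (Real.pi * w) := by
    rw [mul_sub, mul_one, Complex.sin_sub_pi]
  have h3 : b + (w - 1) - 1 = b - 1 + w - 1 := by ring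
  rw [lerchIntegrand, lerchIntegrand, h1, h2, h3]
  ring

lemma integral_lerchIntegrand_step (m : ℕ) {y : ℂ} (hy : 1 ≤ ‖y‖) (harg : |arg y| < Real.pi)
    {x : ℝ} (hx0 : 0 < x) (hx1 : x < 1) (b : ℂ) :
    (∫ t : ℝ, lerchIntegrand m y b (x + t * I)) +
      y⁻¹ * ∫ t : ℝ, lerchIntegrand m y (b - 1) (x + t * I) =
      2 * Real.pi * (y⁻¹ * (b - 1) ^ m) := by
  have hy0 : y ≠ 0 := norm_pos_iff.1 (by linarith)
  have hkβ : ∀ k : ℤ, x ≠ k := ne_intCast_of_lt_of_lt (n := 0) (by simpa) (by simpa)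
  have hkα : ∀ k : ℤ, x - 1 ≠ k :=
    ne_intCast_of_lt_of_lt (n := -1) (by push_cast; linarith) (by push_cast; linarith)
  set S : ℂ → ℂ := fun w => Complex.sin (Real.pi * w) with hS
  have hSd : Differentiable ℂ S := by fun_prop
  have hS0 : dslope S 0 0 = Real.pi := by
    have : HasDerivAt S (Real.pi : ℂ) 0 := by
      have := ((hasDerivAt_id (0 : ℂ)).const_mul (Real.pi : ℂ)).csin
      simpa using this
    rw [dslope_same, this.deriv]
  have hSne : ∀ w : ℂ, w ≠ 0 → dslope S 0 w = S w / w := by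
    intro w hw
    rw [dslope_of_ne _ hw, slope_def_field]
    simp [hS]
  set U : Set ℂ := {w | -1 < w.re ∧ w.re < 1} with hUdef
  have hU : IsOpen U :=
    (isOpen_lt continuous_const continuous_re).inter (isOpen_lt continuous_re continuous_const)
  have h0U : (0 : ℂ) ∈ U := by simp [hUdef]
  have hDd : DifferentiableOn ℂ (dslope S 0) U :=
    (Complex.differentiableOn_dslope (hU.mem_nhds h0U)).2 hSd.differentiableOn
  have hDne : ∀ w ∈ U, dslope S 0 w ≠ 0 := by
    intro w hw
    rcases eq_or_ne w 0 with rfl | hw0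
    · rw [hS0]
      exact ofReal_ne_zero.2 Real.pi_ne_zero
    · rw [hSne w hw0]
      refine div_ne_zero (fun h0 => hw0 ?_) hw0
      obtain ⟨k, hk⟩ := Complex.sin_eq_zero_iff.1 h0
      have hwk : w = k := by
        rw [mul_comm] at hk
        exact mul_right_cancel₀ (ofReal_ne_zero.2 Real.pi_ne_zero) hk
      rw [hwk, hUdef, mem_ofPred_eq, intCast_re] at hw
      have h1 : (-1 : ℤ) < k := by exact_mod_cast hw.1
      have h2 : k < (1 : ℤ) := by exact_mod_cast hw.2
      rw [hwk, show k = 0 by omega, Int.cast_zero]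
  set u : ℂ → ℂ := fun w => Real.pi * y ^ (w - 1) * (b + w - 1) ^ m / dslope S 0 w with hu
  have hud : DifferentiableOn ℂ u U := by
    refine DifferentiableOn.div (Differentiable.differentiableOn ?_) hDd hDne
    refine Differentiable.mul ((differentiable_const _).mul ?_) (by fun_prop)
    exact Differentiable.const_cpow (by fun_prop) (Or.inl hy0)
  have huL : ∀ w : ℂ, w ≠ 0 → u w / w = lerchIntegrand m y b w := by
    intro w hw
    simp only [hu, hSne w hw, lerchIntegrand]
    rw [div_div, div_mul_cancel₀ _ hw]
  have hne : ∀ {v : ℝ}, v ≠ 0 → ∀ t : ℝ, (v : ℂ) + t * I ≠ 0 :=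
    fun hv t h => hv (by simpa using congrArg re h)
  have hx1' : x - 1 ≠ 0 := by linarith
  have hiβ := (exists_integrable_lerchIntegrand m hy harg ⟨by linarith, hx1.le⟩ hkβ).1 b
  have hiα := (exists_integrable_lerchIntegrand m hy harg (x := x - 1)
    ⟨by linarith, by linarith⟩ hkα).1 b
  obtain ⟨δ, K, hδ, hK, -, hhor⟩ := exists_norm_lerchIntegrand_le m hy harg
  have hB : Tendsto (fun T : ℝ => (‖b‖ + 2) ^ m * K * Real.exp (-δ * T)) atTop (𝓝 0) := by
    have : Tendsto (fun T : ℝ => Real.exp (-δ * T)) atTop (𝓝 0) :=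
      Real.tendsto_exp_atBot.comp (tendsto_id.const_mul_atTop_of_neg (neg_lt_zero.2 hδ))
    simpa using this.const_mul ((‖b‖ + 2) ^ m * K)
  have key := integral_vertical_sub_eq_two_pi_mul_residue hU (α := x - 1) (β := x)
    (by linarith) hx0 (fun w hw => ⟨by linarith [hw.1, hx0], by linarith [hw.2]⟩) hud
    (by simpa only [huL _ (hne hx1' _)] using hiα)
    (by simpa only [huL _ (hne hx0.ne' _)] using hiβ) hB (by
      filter_upwards [eventually_ge_atTop 1] with T hT v hv t ht
      have hw : (v : ℂ) + t * I ≠ 0 := fun h => by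
        have h' : t = 0 := by simpa using congrArg im h
        rw [h', abs_zero] at ht
        linarith
      rw [huL _ hw, ← ht]
      exact hhor b v ⟨by linarith [hv.1], by linarith [hv.2]⟩ t (by rwa [ht]))
  simp only [huL _ (hne hx1' _), huL _ (hne hx0.ne' _)] at key
  have hshift : ∀ t : ℝ, lerchIntegrand m y b ((x - 1 : ℝ) + t * I) =
      -(y⁻¹ * lerchIntegrand m y (b - 1) (x + t * I)) := fun t => by
    rw [← lerchIntegrand_sub_one m hy0]
    congr 1
    push_cast
    ring
  have hu0 : u 0 = y⁻¹ * (b - 1) ^ m := by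
    have hpi : (Real.pi : ℂ) ≠ 0 := ofReal_ne_zero.2 Real.pi_ne_zero
    simp only [hu, hS0, zero_sub, add_zero, cpow_neg_one]
    field_simp
  simp only [hshift, integral_neg, integral_const_mul, hu0] at key
  rw [← key]
  ring

lemma integral_lerchIntegrand_eq_sum (m : ℕ) {y : ℂ} (hy : 1 ≤ ‖y‖) (harg : |arg y| < Real.pi)
    {x : ℝ} (hx0 : 0 < x) (hx1 : x < 1) (a : ℂ) (N : ℕ) :
    ∫ t : ℝ, lerchIntegrand m y a (x + t * I) =
      ((-y)⁻¹) ^ N * (∫ t : ℝ, lerchIntegrand m y (a - N) (x + t * I)) -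
      2 * Real.pi * ∑ n ∈ Finset.range N, (a - (n + 1)) ^ m * ((-y)⁻¹) ^ (n + 1) := by
  induction N with
  | zero => simp
  | succ N ih =>
    have h := integral_lerchIntegrand_step m hy harg hx0 hx1 (a - N)
    rw [sub_sub] at h
    rw [ih, Finset.sum_range_succ]
    push_cast
    rw [pow_succ, inv_neg]
    linear_combination (-y⁻¹) ^ N * h

lemma summable_add_pow_mul_pow (m : ℕ) (b : ℂ) {r : ℂ} (hr : ‖r‖ < 1) :
    Summable fun n : ℕ => (b - (n + 1)) ^ m * r ^ (n + 1) := by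
  have hs : Summable fun n : ℕ => (‖b‖ + 2) ^ m * (((n + 1 : ℕ) : ℝ) ^ m * ‖r‖ ^ (n + 1)) := by
    refine Summable.mul_left _ ?_
    exact (summable_nat_add_iff 1).2 (summable_pow_mul_geometric_of_norm_lt_one m
      (r := ‖r‖) (by rwa [norm_norm]))
  refine Summable.of_norm_bounded hs fun n => ?_
  rw [norm_mul, norm_pow, norm_pow, ← mul_assoc, ← mul_pow]
  gcongr
  refine (norm_sub_le _ _).trans ?_
  have : ‖(n : ℂ) + 1‖ = n + 1 := by
    rw [← Nat.cast_add_one, Complex.norm_natCast, Nat.cast_add_one]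
  rw [this]
  push_cast
  nlinarith [mul_nonneg (norm_nonneg b) (Nat.cast_nonneg (α := ℝ) n), Nat.cast_nonneg (α := ℝ) n]

theorem integral_lerchIntegrand (m : ℕ) {y : ℂ} (hy : 1 < ‖y‖) (harg : |arg y| < Real.pi)
    {x : ℝ} (hx0 : 0 < x) (hx1 : x < 1) (a : ℂ) :
    ∫ t : ℝ, lerchIntegrand m y a (x + t * I) =
      -(2 * Real.pi * ∑' n : ℕ, (a - (n + 1)) ^ m * ((-y)⁻¹) ^ (n + 1)) := by
  have hr : ‖(-y)⁻¹‖ < 1 := by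
    rw [norm_inv, norm_neg]
    exact inv_lt_one_of_one_lt₀ hy
  obtain ⟨-, C, hC⟩ := exists_integrable_lerchIntegrand m hy.le harg (x := x)
    ⟨by linarith, hx1.le⟩ (ne_intCast_of_lt_of_lt (n := 0) (by simpa) (by simpa))
  have hC0 : 0 ≤ C := by
    have h := (norm_nonneg _).trans (hC 0)
    exact nonneg_of_mul_nonneg_right h (by positivity)
  have hrem : Tendsto (fun N : ℕ => ((-y)⁻¹) ^ N *
      ∫ t : ℝ, lerchIntegrand m y (a - N) (x + t * I)) atTop (𝓝 0) := by
    have hlim : Tendsto (fun N : ℕ => (‖a‖ + 3) ^ m * C * ‖(-y)⁻¹‖⁻¹ *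
        (((N + 1 : ℕ) : ℝ) ^ m * ‖(-y)⁻¹‖ ^ (N + 1))) atTop (𝓝 0) := by
      have := (tendsto_pow_const_mul_const_pow_of_abs_lt_one m
        (r := ‖(-y)⁻¹‖) (by rwa [abs_norm])).comp (tendsto_add_atTop_nat 1)
      simpa using this.const_mul ((‖a‖ + 3) ^ m * C * ‖(-y)⁻¹‖⁻¹)
    refine squeeze_zero_norm (fun N => ?_) hlim
    have hr0 : ‖(-y)⁻¹‖ ≠ 0 := by
      rw [norm_inv, norm_neg]
      positivity
    have hb : ‖a - N‖ + 2 ≤ (‖a‖ + 3) * ((N + 1 : ℕ) : ℝ) := by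
      have := norm_sub_le a N
      rw [Complex.norm_natCast] at this
      push_cast
      nlinarith [mul_nonneg (norm_nonneg a) (Nat.cast_nonneg (α := ℝ) N),
        Nat.cast_nonneg (α := ℝ) N]
    rw [norm_mul, norm_pow]
    calc ‖(-y)⁻¹‖ ^ N * ‖∫ t : ℝ, lerchIntegrand m y (a - N) (x + t * I)‖
        ≤ ‖(-y)⁻¹‖ ^ N * (((‖a‖ + 3) * ((N + 1 : ℕ) : ℝ)) ^ m * C) := by
          gcongr
          exact (hC _).trans (by gcongr)
      _ = _ := by
          rw [mul_pow, pow_succ ‖(-y)⁻¹‖]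
          linear_combination (-(‖(-y)⁻¹‖ ^ N * (‖a‖ + 3) ^ m * ((N + 1 : ℕ) : ℝ) ^ m * C)) *
            mul_inv_cancel₀ hr0
  have hsum := (summable_add_pow_mul_pow m a hr).hasSum.tendsto_sum_nat
  have hlim := hrem.sub (hsum.const_mul (2 * Real.pi : ℂ))
  rw [zero_sub] at hlim
  exact tendsto_nhds_unique (tendsto_const_nhds.congr
    (integral_lerchIntegrand_eq_sum m hy.le harg hx0 hx1 a)) hlim

lemma Gamma_mul_Gamma_mul_eq_lerchIntegrand (m : ℕ) (y a s : ℂ) :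
    Complex.Gamma (1 + s) * Complex.Gamma (-s) * y ^ s * (a + s) ^ m =
      lerchIntegrand m y a (s + 1) := by
  have h := Complex.Gamma_mul_Gamma_one_sub (1 + s)
  rw [show 1 - (1 + s) = -s by ring] at h
  rw [h, lerchIntegrand, add_sub_cancel_right, add_comm 1 s, ← add_assoc, add_sub_cancel_right]
  ring

/-- For `s = -m` a non-positive integer, the large-`z` expansion of the
Lerch transcendent has no branch-point contribution: for `0 < Re a < 1`,
`-Re a < c < 0`, `|z| > 1`, `z ∉ [0,∞)`,
`(1/2π) ∫ Γ(1+c+it) Γ(-c-it) (-z)^(c+it) (a+c+it)^m dt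
  = -(-1)^m ∑_{n=1}^∞ (n-a)^m z^(-n)`. -/
theorem lerch_nonpositive_integer_s (m : ℕ) (a : ℂ) (c : ℝ) (z : ℂ)
    (ha1 : 0 < a.re) (ha2 : a.re < 1) (hc1 : -a.re < c) (hc2 : c < 0)
    (hz1 : 1 < ‖z‖) (hz2 : ∀ r : ℝ, 0 ≤ r → z ≠ r) :
    Integrable (fun t : ℝ =>
      Complex.Gamma (1 + ((c : ℂ) + t * I)) * Complex.Gamma (-((c : ℂ) + t * I)) *
        (-z) ^ ((c : ℂ) + t * I) * (a + ((c : ℂ) + t * I)) ^ m) ∧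
    (1 / (2 * (Real.pi : ℂ))) *
      ∫ t : ℝ,
        Complex.Gamma (1 + ((c : ℂ) + t * I)) * Complex.Gamma (-((c : ℂ) + t * I)) *
          (-z) ^ ((c : ℂ) + t * I) * (a + ((c : ℂ) + t * I)) ^ m
      = -(-1) ^ m * ∑' n : ℕ, ((n : ℂ) + 1 - a) ^ m * z ^ (-((n : ℤ) + 1)) := by
  have hx0 : 0 < c + 1 := by linarith
  have hx1 : c + 1 < 1 := by linarith
  have hy : 1 < ‖-z‖ := by rwa [norm_neg]
  have harg : |arg (-z)| < Real.pi := by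
    refine lt_of_le_of_ne (abs_arg_le_pi _) fun h => ?_
    have h' : arg (-z) = Real.pi := by
      rcases abs_eq Real.pi_pos.le |>.1 h with h | h
      · exact h
      · exact absurd h (neg_pi_lt_arg _).ne'
    obtain ⟨hre, him⟩ := arg_eq_pi_iff.1 h'
    rw [neg_re] at hre
    rw [neg_im, neg_eq_zero] at him
    exact hz2 z.re (by linarith) (Complex.ext (by simp) (by simpa using him))
  have hL : ∀ t : ℝ, Complex.Gamma (1 + ((c : ℂ) + t * I)) * Complex.Gamma (-((c : ℂ) + t * I)) *
      (-z) ^ ((c : ℂ) + t * I) * (a + ((c : ℂ) + t * I)) ^ m =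
      lerchIntegrand m (-z) a ((c + 1 : ℝ) + t * I) := fun t => by
    rw [Gamma_mul_Gamma_mul_eq_lerchIntegrand]
    congr 1
    push_cast
    ring
  simp only [hL]
  refine ⟨(exists_integrable_lerchIntegrand m hy.le harg ⟨by linarith, hx1.le⟩
    (ne_intCast_of_lt_of_lt (n := 0) (by simpa) (by simpa))).1 a, ?_⟩
  have hpi : (Real.pi : ℂ) ≠ 0 := ofReal_ne_zero.2 Real.pi_ne_zero
  have hterm : ∀ n : ℕ, (a - (n + 1)) ^ m * z⁻¹ ^ (n + 1) =
      (-1) ^ m * (((n : ℂ) + 1 - a) ^ m * z ^ (-((n : ℤ) + 1))) := fun n => by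
    rw [← mul_assoc, ← mul_pow, zpow_neg, ← inv_zpow, ← Nat.cast_add_one (R := ℤ), zpow_natCast]
    congr 2
    ring
  rw [integral_lerchIntegrand m hy harg hx0 hx1 a, neg_neg, tsum_congr hterm, tsum_mul_left]
  field_simp
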